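/- Let p ≥ 1, c ≥ 1 be integers and b = pc + 1. Say that X = (X_1,…,X_n) ∈ {0,…,b−1}^n has a descent at k ∈ {1,…,n−1} if X_k > X_{k+1}, and a descent at n if X_n > c. Let 0 = s_0 < s_1 < ⋯ < s_k < n and set s_{k+1} := n. Then the number of X ∈ {0,…,b−1}^n whose descent set equals {s_1,…,s_k} is det( f(i,j) )_{i,j = 0,…,k}, where f(i,j) = binom(s_{j+1} − s_i + b − 1, b − 1) for 0 ≤ i ≤ k and 0 ≤ j ≤ k−1, and f(i,k) = binom(n − s_i + c, c) for 0 ≤ i ≤ k. -/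

import Mathlib

open scoped Classical

noncomputable section

/-- Binomial coefficient with integer top, taken to be `0` when the top is negative
(so in particular `zchoose a r = 0` whenever `a < r`). -/
def zchoose (a : ℤ) (r : ℕ) : ℕ := if 0 ≤ a then a.toNat.choose r else 0

/-- `X ∈ {0,…,b-1}ⁿ` has a descent at position `i+1` (positions `1,…,n`):
at positions `k < n` this means `X_k > X_{k+1}`, and at position `n` it means `X_n > c`. -/
def seqHasDescentAt (c : ℕ) {n b : ℕ} (X : Fin n → Fin b) (i : Fin n) : Prop :=
  if h : (i : ℕ) + 1 < n then X ⟨(i : ℕ) + 1, h⟩ < X i else c < (X i : ℕ)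

/-- The set of descent positions (a subset of `{1,…,n}`) of `X ∈ {0,…,b-1}ⁿ`. -/
def seqDescentSet (c : ℕ) {n b : ℕ} (X : Fin n → Fin b) : Finset ℕ :=
  (Finset.univ.filter fun i : Fin n => seqHasDescentAt c X i).image fun i => (i : ℕ) + 1

def TT (b : ℕ) : Matrix (Fin b) (Fin b) ℤ := Matrix.of fun x y => if x ≤ y then 1 else 0

def ec (b c : ℕ) : Fin b → ℤ := fun x => if (x : ℕ) ≤ c then 1 else 0

def SS {b : ℕ} (v : Fin b → ℤ) : ℤ := ∑ x, v x

lemma hockey (m c x : ℕ) (hx : x ≤ c) :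
    ∑ y ∈ Finset.Icc x c, (m + (c - y)).choose m = (m + 1 + (c - x)).choose (m + 1) := by
  have := Nat.sum_Icc_choose (m + (c - x)) m
  rw [show m + 1 + (c - x) = m + (c - x) + 1 by omega, ← this]
  apply Finset.sum_bij' (fun y _ => m + (c - y)) (fun z _ => c - (z - m))
  all_goals simp only [Finset.mem_Icc]
  all_goals intros
  all_goals first | omega | trivial

lemma TT_pow_ec (B c m : ℕ) (hc : c ≤ B) (x : Fin (B + 1)) :
    ((TT (B + 1)) ^ m).mulVec (ec (B + 1) c) x =
      if (x : ℕ) ≤ c then ((m + (c - x)).choose m : ℤ) else 0 := by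
  induction m generalizing x with
  | zero => simp [ec]
  | succ m ih =>
    rw [pow_succ', ← Matrix.mulVec_mulVec, Matrix.mulVec, dotProduct]
    simp only [ih]
    simp only [TT, Matrix.of_apply]
    have h1 : ∀ y : Fin (B+1), (if x ≤ y then (1:ℤ) else 0) *
        (if (y : ℕ) ≤ c then ((m + (c - y)).choose m : ℤ) else 0) =
        (fun y : ℕ => if y ∈ Finset.Icc (x:ℕ) c then ((m + (c - y)).choose m : ℤ) else 0) y := by
      intro y
      simp only [Finset.mem_Icc, Fin.le_def]
      split_ifs <;> simp_all
    simp only [h1]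
    rw [Fin.sum_univ_eq_sum_range
      (fun y : ℕ => if y ∈ Finset.Icc (x:ℕ) c then ((m + (c - y)).choose m : ℤ) else 0)]
    rw [← Finset.sum_filter]
    have h2 : (Finset.range (B+1)).filter (fun y => y ∈ Finset.Icc (x:ℕ) c) = Finset.Icc (x:ℕ) c := by
      ext y; simp; omega
    rw [h2]
    split_ifs with h
    · exact_mod_cast hockey m c x h
    · rw [Finset.Icc_eq_empty h]; simp

lemma SS_TT (B : ℕ) (v : Fin (B + 1) → ℤ) : SS v = (TT (B + 1)).mulVec v 0 := by
  simp [SS, TT, Matrix.mulVec, dotProduct]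

lemma SS_pow_ec (B c m : ℕ) (hc : c ≤ B) :
    SS (((TT (B + 1)) ^ m).mulVec (ec (B + 1) c)) = ((m + 1 + c).choose c : ℤ) := by
  rw [SS_TT, Matrix.mulVec_mulVec, ← pow_succ', TT_pow_ec B c _ hc]
  simp [Nat.choose_symm_add]

def EE (b c : ℕ) : ℕ → (ℕ → Prop) → Fin b → ℤ
  | 0, D, x => if (c < (x : ℕ) ↔ D 0) then 1 else 0
  | l + 1, D, x => ∑ y, if (y < x ↔ D 0) then EE b c l (fun q => D (q + 1)) y else 0

lemma desc_cons {b c l : ℕ} (x : Fin b) (Y : Fin (l + 1) → Fin b) (j : Fin (l + 1)) :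
    seqHasDescentAt c (Fin.cons x Y : Fin (l + 2) → Fin b) j.succ ↔ seqHasDescentAt c Y j := by
  unfold seqHasDescentAt
  by_cases h : (j : ℕ) + 1 < l + 1
  · have h' : (j.succ : ℕ) + 1 < l + 1 + 1 := by simp; omega
    rw [dif_pos h, dif_pos h']
    have : (⟨(j.succ : ℕ) + 1, h'⟩ : Fin (l + 2)) = Fin.succ ⟨(j : ℕ) + 1, h⟩ := by ext; simp
    rw [this, Fin.cons_succ, Fin.cons_succ]
  · have h' : ¬ (j.succ : ℕ) + 1 < l + 1 + 1 := by simp; omega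
    rw [dif_neg h, dif_neg h', Fin.cons_succ]

lemma sum_cons {b l : ℕ} (f : (Fin (l + 1) → Fin b) → ℤ) :
    ∑ X, f X = ∑ y : Fin b, ∑ Z : Fin l → Fin b, f (Fin.cons y Z) := by
  rw [← Fintype.sum_prod_type']
  exact (Equiv.sum_comp (Fin.consEquiv (fun _ : Fin (l + 1) => Fin b)) f).symm

lemma EE_eq (b c l : ℕ) (D : ℕ → Prop) (x : Fin b) :
    EE b c l D x = ∑ Y : Fin l → Fin b,
      if (∀ i : Fin (l + 1), seqHasDescentAt c (Fin.cons x Y : Fin (l + 1) → Fin b) i ↔ D i)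
        then 1 else 0 := by
  induction l generalizing D x with
  | zero => simp [EE, seqHasDescentAt]
  | succ l ih =>
    rw [sum_cons]
    simp only [EE]
    refine Finset.sum_congr rfl fun y _ => ?_
    have key : ∀ Z : Fin l → Fin b, (∀ i : Fin (l + 2), seqHasDescentAt c
        (Fin.cons x (Fin.cons y Z : Fin (l + 1) → Fin b) : Fin (l + 2) → Fin b) i ↔ D i) ↔
        (y < x ↔ D 0) ∧ (∀ i : Fin (l + 1), seqHasDescentAt c
          (Fin.cons y Z : Fin (l + 1) → Fin b) i ↔ D (i + 1)) := by
      intro Z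
      rw [Fin.forall_fin_succ]
      simp only [desc_cons, Fin.val_succ]
      refine and_congr_left fun _ => ?_
      have h0 : seqHasDescentAt c
        (Fin.cons x (Fin.cons y Z : Fin (l + 1) → Fin b) : Fin (l + 2) → Fin b) 0 ↔ y < x := by
        unfold seqHasDescentAt
        rw [dif_pos (by simp)]
        rfl
      rw [h0]; rfl
    simp only [key]
    rw [ih]
    split_ifs with h
    · simp [h]
    · simp [h]

lemma count_eq (b c l : ℕ) (D : ℕ → Prop) :
    ((Finset.univ.filter fun X : Fin (l + 1) → Fin b =>
        ∀ i : Fin (l + 1), seqHasDescentAt c X i ↔ D i).card : ℤ) = SS (EE b c l D) := by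
  rw [Finset.card_filter]
  push_cast
  rw [sum_cons]
  simp only [SS, EE_eq]

lemma EE_asc (b c l : ℕ) (D : ℕ → Prop) (h : ¬ D 0) :
    EE b c (l + 1) D = (TT b).mulVec (EE b c l fun q => D (q + 1)) := by
  ext x
  simp [EE, TT, Matrix.mulVec, dotProduct, h]

lemma EE_desc (B c l : ℕ) (D : ℕ → Prop) (h : D 0) :
    EE (B + 1) c (l + 1) D = SS (EE (B + 1) c l fun q => D (q + 1)) • ec (B + 1) B
      - (TT (B + 1)).mulVec (EE (B + 1) c l fun q => D (q + 1)) := by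
  ext x
  have : ec (B + 1) B x = 1 := by simp [ec]; omega
  simp only [Pi.sub_apply, Pi.smul_apply, this, EE, TT, Matrix.mulVec, dotProduct, h, SS,
    Matrix.of_apply, iff_true, smul_eq_mul, mul_one]
  rw [← Finset.sum_sub_distrib]
  refine Finset.sum_congr rfl fun y _ => ?_
  by_cases hy : y < x
  · simp [hy, not_le.mpr hy]
  · simp [hy, not_lt.mp hy]

lemma EE_zero (b c : ℕ) (D : ℕ → Prop) (h : ¬ D 0) : EE b c 0 D = ec b c := by
  ext x; simp [EE, ec, h]

/-- block of ascents -/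
lemma EE_block (b c l r : ℕ) (D : ℕ → Prop) (h : ∀ q < r, ¬ D q) :
    EE b c (l + r) D = ((TT b) ^ r).mulVec (EE b c l fun q => D (q + r)) := by
  induction r generalizing D with
  | zero => simp
  | succ r ih =>
    rw [← add_assoc, EE_asc _ _ _ _ (h 0 (by omega)), ih _ (fun q hq => h (q + 1) (by omega)),
      Matrix.mulVec_mulVec, ← pow_succ']
    congr! 3

def GG (B c k j q : ℕ) : ℤ := if j = k + 1 then ((q + c).choose c : ℤ) else ((q + B).choose B : ℤ)

def uu (B c n k : ℕ) (s : ℕ → ℕ) (i : ℕ) : Fin (B + 1) → ℤ :=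
  EE (B + 1) c (n - 1 - s i) (fun q => s i + q + 1 ∈ (Finset.Icc 1 k).image s)

def aa (B c n k : ℕ) (s : ℕ → ℕ) (j : ℕ) : ℤ := if j = k + 1 then 1 else SS (uu B c n k s j)

lemma SS_sub {b : ℕ} (v w : Fin b → ℤ) : SS (v - w) = SS v - SS w := by simp [SS]
lemma SS_smul {b : ℕ} (a : ℤ) (w : Fin b → ℤ) : SS (a • w) = a * SS w := by
  simp [SS, Finset.mul_sum]

section
variable (B c n k : ℕ) (s : ℕ → ℕ) (hmono : ∀ i, i ≤ k → s i < s (i + 1))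
    (hlast : s (k + 1) = n)

lemma s_le (k : ℕ) (s : ℕ → ℕ) (hmono : ∀ i, i ≤ k → s i < s (i + 1)) (i j : ℕ) (hij : i ≤ j)
    (hj : j ≤ k + 1) : s i ≤ s j := by
  induction j, hij using Nat.le_induction with
  | base => rfl
  | succ j hij ih => have := hmono j (by omega); have := ih (by omega); omega

lemma s_lt (k : ℕ) (s : ℕ → ℕ) (hmono : ∀ i, i ≤ k → s i < s (i + 1)) (i j : ℕ) (hij : i < j)
    (hj : j ≤ k + 1) : s i < s j := by
  have := s_le k s hmono (i + 1) j hij hj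
  have := hmono i (by omega)
  omega

lemma gap (k : ℕ) (s : ℕ → ℕ) (hmono : ∀ i, i ≤ k → s i < s (i + 1)) (i : ℕ) (hi : i ≤ k)
    (t : ℕ) (h1 : s i < t) (h2 : t < s (i + 1)) : t ∉ (Finset.Icc 1 k).image s := by
  simp only [Finset.mem_image, Finset.mem_Icc, not_exists, not_and]
  rintro j ⟨_, hj⟩ rfl
  rcases Nat.lt_or_ge i j with h | h
  · have := s_le k s hmono (i + 1) j h (by omega)
    omega
  · have := s_le k s hmono j i h (by omega)
    omega

include hmono hlast

lemma uu_last (hc : c ≤ B) : uu B c n k s k = (TT (B + 1) ^ (n - s k - 1)).mulVec (ec (B + 1) c) := by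
  have h1 := hmono k le_rfl
  unfold uu
  rw [show n - 1 - s k = 0 + (n - s k - 1) by omega, EE_block, EE_zero]
  · simp only [zero_add]
    rw [show s k + (n - s k - 1) + 1 = s (k + 1) by omega]
    simp only [Finset.mem_image, Finset.mem_Icc, not_exists, not_and]
    rintro j ⟨_, hj⟩ h
    have := s_lt k s hmono j (k + 1) (by omega) le_rfl
    omega
  · intro q hq
    exact gap k s hmono k le_rfl _ (by omega) (by omega)

lemma uu_step (i : ℕ) (hi : i < k) : uu B c n k s i =
    (TT (B + 1) ^ (s (i + 1) - s i - 1)).mulVec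
      (SS (uu B c n k s (i + 1)) • ec (B + 1) B - (TT (B + 1)).mulVec (uu B c n k s (i + 1))) := by
  have h1 := hmono i hi.le
  have h2 := s_lt k s hmono (i + 1) (k + 1) (by omega) le_rfl
  conv_lhs => unfold uu
  rw [show n - 1 - s i = (n - 1 - s (i + 1)) + 1 + (s (i + 1) - s i - 1) by omega, EE_block,
    EE_desc]
  · have : (fun q => s i + (q + 1 + (s (i + 1) - s i - 1)) + 1 ∈ (Finset.Icc 1 k).image s) =
      (fun q => s (i + 1) + q + 1 ∈ (Finset.Icc 1 k).image s) := by
      ext q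
      rw [show s i + (q + 1 + (s (i + 1) - s i - 1)) + 1 = s (i + 1) + q + 1 by omega]
    rw [this]; rfl
  · rw [show s i + (0 + (s (i + 1) - s i - 1)) + 1 = s (i + 1) by omega]
    exact Finset.mem_image_of_mem _ (by simp; omega)
  · intro q hq
    exact gap k s hmono i hi.le _ (by omega) (by omega)

lemma main_rec (hc : c ≤ B) (i : ℕ) (hi : i ≤ k) : ∀ m : ℕ,
    (-1) ^ i * SS ((TT (B + 1) ^ m).mulVec (uu B c n k s i)) =
      - ∑ j ∈ Finset.Ioc i (k + 1), (-1) ^ j * aa B c n k s j * GG B c k j (s j - s i + m) := by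
  induction hi using Nat.decreasingInduction with
  | self =>
    intro m
    have h1 := hmono k le_rfl
    rw [uu_last B c n k s hmono hlast hc, Matrix.mulVec_mulVec, ← pow_add, SS_pow_ec _ _ _ hc]
    rw [show Finset.Ioc k (k + 1) = {k + 1} by ext; simp]
    simp only [Finset.sum_singleton, aa, GG, if_true]
    rw [show m + (n - s k - 1) + 1 + c = s (k + 1) - s k + m + c by omega]
    ring
  | of_succ i hi ih =>
    intro m
    have h1 := hmono i hi.le
    have hins : Finset.Ioc i (k + 1) = insert (i + 1) (Finset.Ioc (i + 1) (k + 1)) := by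
      ext; simp; omega
    rw [hins, Finset.sum_insert (by simp)]
    have ih' := ih (s (i + 1) - s i + m)
    have hs : ∑ j ∈ Finset.Ioc (i + 1) (k + 1),
        (-1) ^ j * aa B c n k s j * GG B c k j (s j - s i + m) =
        ∑ j ∈ Finset.Ioc (i + 1) (k + 1), (-1) ^ j * aa B c n k s j *
          GG B c k j (s j - s (i + 1) + (s (i + 1) - s i + m)) := by
      refine Finset.sum_congr rfl fun j hj => ?_
      rw [Finset.mem_Ioc] at hj
      have := s_le k s hmono (i + 1) j hj.1.le hj.2
      rw [show s j - s (i + 1) + (s (i + 1) - s i + m) = s j - s i + m by omega]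
    rw [hs, neg_add, ← ih', uu_step B c n k s hmono hlast i hi, Matrix.mulVec_mulVec, ← pow_add,
      Matrix.mulVec_sub, Matrix.mulVec_smul, Matrix.mulVec_mulVec, ← pow_succ, SS_sub, SS_smul,
      SS_pow_ec _ _ _ le_rfl]
    have ha : aa B c n k s (i + 1) = SS (uu B c n k s (i + 1)) := by
      rw [aa, if_neg (by omega)]
    have hg : GG B c k (i + 1) (s (i + 1) - s i + m) =
        ((m + (s (i + 1) - s i - 1) + 1 + B).choose B : ℤ) := by
      rw [GG, if_neg (by omega), show m + (s (i + 1) - s i - 1) + 1 + B = s (i + 1) - s i + m + B by omega]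
    rw [ha, hg, show m + (s (i + 1) - s i - 1) + 1 = s (i + 1) - s i + m by omega]
    ring

lemma det_eq (hc : c ≤ B) (M : Matrix (Fin (k + 1)) (Fin (k + 1)) ℤ)
    (hM : ∀ i j : Fin (k + 1), (i : ℕ) ≤ j → M i j = GG B c k (j + 1) (s (j + 1) - s i))
    (hM1 : ∀ i j : Fin (k + 1), (i : ℕ) = j + 1 → M i j = 1)
    (hM0 : ∀ i j : Fin (k + 1), (j : ℕ) + 1 < i → M i j = 0) :
    M.det = SS (uu B c n k s 0) := by
  let v : Fin (k + 1) → ℤ := fun j => (-1) ^ ((j : ℕ) + 1) * aa B c n k s (j + 1)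
  have hv : M.mulVec v = Pi.single 0 (- SS (uu B c n k s 0)) := by
    ext i
    have hrec := main_rec B c n k s hmono hlast hc i (by omega) 0
    simp only [pow_zero, Matrix.one_mulVec, add_zero] at hrec
    let f : ℕ → ℤ := fun j => (-1) ^ j * aa B c n k s j *
      (if (i : ℕ) < j then GG B c k j (s j - s i) else if (i : ℕ) = j then 1 else 0)
    have e1 : M.mulVec v i = ∑ j : Fin (k + 1), f (j + 1) := by
      rw [Matrix.mulVec, dotProduct]
      refine Finset.sum_congr rfl fun j _ => ?_
      simp only [f, v]
      rw [mul_comm]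
      congr 1
      split_ifs with h1 h2
      · exact hM i j (by omega)
      · exact hM1 i j h2
      · exact hM0 i j (by omega)
    have e2 : ∑ j : Fin (k + 1), f (j + 1) = ∑ j ∈ Finset.range (k + 2), f j - f 0 := by
      rw [Finset.sum_range_succ', Fin.sum_univ_eq_sum_range (fun j => f (j + 1))]
      ring
    have e3 : ∑ j ∈ Finset.range (k + 2), f j = 0 := by
      have hsub : insert (i : ℕ) (Finset.Ioc (i : ℕ) (k + 1)) ⊆ Finset.range (k + 2) := by
        intro j; simp; omega
      rw [← Finset.sum_subset hsub, Finset.sum_insert (by simp)]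
      · have : ∑ j ∈ Finset.Ioc (i : ℕ) (k + 1), f j = ∑ j ∈ Finset.Ioc (i : ℕ) (k + 1),
            (-1) ^ j * aa B c n k s j * GG B c k j (s j - s i) := by
          refine Finset.sum_congr rfl fun j hj => ?_
          rw [Finset.mem_Ioc] at hj
          simp only [f, if_pos hj.1]
        rw [this]
        have ha : aa B c n k s i = SS (uu B c n k s i) := by
          rw [aa, if_neg (by omega)]
        simp only [f, lt_irrefl, if_false, if_true, mul_one, ha]
        rw [hrec]; ring
      · intro j h1 h2
        simp only [Finset.mem_insert, Finset.mem_Ioc, Finset.mem_range] at h1 h2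
        simp only [f]
        rw [if_neg (by omega), if_neg (by omega), mul_zero]
    rw [e1, e2, e3]
    by_cases hi : i = 0
    · subst hi
      simp [f, aa]
    · have : (i : ℕ) ≠ 0 := fun h => hi (Fin.ext h)
      simp [f, hi, this]
  have h1 : (M.adjugate.mulVec (M.mulVec v)) (Fin.last k) = M.det * v (Fin.last k) := by
    rw [Matrix.mulVec_mulVec, Matrix.adjugate_mul, Matrix.smul_mulVec, Matrix.one_mulVec]
    simp
  have h2 : M.adjugate (Fin.last k) 0 = (-1) ^ k := by
    rw [Matrix.adjugate_fin_succ_eq_det_submatrix]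
    have : (M.submatrix (Fin.succAbove 0) (Fin.succAbove (Fin.last k))).det = 1 := by
      rw [Matrix.det_of_isUpperTriangular]
      · apply Finset.prod_eq_one
        intro i _
        rw [Matrix.submatrix_apply]
        exact hM1 _ _ (by simp)
      · intro i j hij
        rw [Matrix.submatrix_apply]
        refine hM0 _ _ ?_
        have : (j : ℕ) < i := hij
        simp; omega
    rw [this]; simp
  rw [hv] at h1
  simp only [Matrix.mulVec_single, h2, v, aa, Fin.val_last, if_true, Pi.smul_apply, Matrix.col_apply] at h1
  have h3 : ((-1 : ℤ) ^ k) * (-1) ^ k = 1 := by rw [← mul_pow]; simp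
  simp [pow_succ] at h1
  have h4 : M.det = M.det * ((-1 : ℤ) ^ k * (-1) ^ k) := by rw [h3, mul_one]
  rw [h4]
  linear_combination (-(-1 : ℤ)^k) * h1 + (SS (uu B c n k s 0)) * h3
end

/-- **Theorem (counting words with prescribed descent set, `b = pc + 1`, case `s_k < n`).**
For `0 = s_0 < s_1 < ⋯ < s_k < n`, `s_{k+1} := n`, the number of `X ∈ {0,…,b-1}ⁿ`
whose descent set equals `{s_1,…,s_k}` is `det(f(i,j))_{i,j=0,…,k}`, with
`f(i,j) = binom(s_{j+1} - s_i + b - 1, b-1)` for `j < k` and `f(i,k) = binom(n - s_i + c, c)`. -/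
theorem statement8 (p c n k : ℕ) (hp : 1 ≤ p) (hc : 1 ≤ c) (hn : 1 ≤ n)
    (b : ℕ) (hb : b = p * c + 1)
    (s : ℕ → ℕ) (hs0 : s 0 = 0) (hmono : ∀ i, i ≤ k → s i < s (i + 1))
    (hlast : s (k + 1) = n) :
    ((Finset.univ.filter fun X : Fin n → Fin b =>
        seqDescentSet c X = (Finset.Icc 1 k).image s).card : ℤ)
      = (Matrix.of fun i j : Fin (k + 1) =>
          if (j : ℕ) = k then (zchoose ((n : ℤ) - s (i : ℕ) + c) c : ℤ)
          else (zchoose ((s ((j : ℕ) + 1) : ℤ) - s (i : ℕ) + b - 1) (b - 1) : ℤ)).det := by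
  obtain ⟨l, rfl⟩ : ∃ l, n = l + 1 := ⟨n - 1, by omega⟩
  have hcB : c ≤ p * c := Nat.le_mul_of_pos_left c hp
  generalize p * c = B at hb hcB
  subst hb
  rw [det_eq B c (l + 1) k s hmono hlast hcB]
  · unfold uu
    rw [hs0, show l + 1 - 1 - 0 = l by omega, ← count_eq]
    congr 2
    ext X
    simp only [Finset.mem_filter, Finset.mem_univ, true_and, zero_add]
    have hsub : ∀ t ∈ (Finset.Icc 1 k).image s, ∃ i : Fin (l + 1), (i : ℕ) + 1 = t := by
      intro t ht
      simp only [Finset.mem_image, Finset.mem_Icc] at ht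
      obtain ⟨j, ⟨hj1, hj2⟩, rfl⟩ := ht
      have h1 := s_lt k s hmono j (k + 1) (by omega) le_rfl
      have h2 := s_lt k s hmono 0 j (by omega) (by omega)
      exact ⟨⟨s j - 1, by omega⟩, by simp; omega⟩
    have hds : ∀ t : ℕ, t ∈ seqDescentSet c X ↔
        ∃ i : Fin (l + 1), seqHasDescentAt c X i ∧ (i : ℕ) + 1 = t := by
      intro t
      simp [seqDescentSet, Finset.bind_def, Finset.pure_def]
    have hmem : ∀ i : Fin (l + 1), (i : ℕ) + 1 ∈ seqDescentSet c X ↔ seqHasDescentAt c X i := by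
      intro i
      rw [hds]
      constructor
      · rintro ⟨j, hj, h⟩
        have : j = i := Fin.ext (by omega)
        exact this ▸ hj
      · intro h; exact ⟨i, h, rfl⟩
    constructor
    · intro h i
      rw [← hmem, h]
    · intro h
      ext t
      constructor
      · intro ht
        obtain ⟨i, hi, rfl⟩ := (hds t).1 ht
        exact (h i).1 hi
      · intro ht
        obtain ⟨i, rfl⟩ := hsub t ht
        exact (hmem i).2 ((h i).2 ht)
  · intro i j hij
    simp only [Matrix.of_apply, GG]
    have h1 := s_le k s hmono i (j + 1) (by omega) (by omega)
    by_cases hj : (j : ℕ) = k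
    · rw [if_pos hj, if_pos (by omega)]
      rw [hj, hlast] at h1 ⊢
      rw [zchoose, if_pos (by omega)]
      congr 2
      omega
    · rw [if_neg hj, if_neg (by omega), zchoose, if_pos (by omega)]
      congr 2
      omega
  · intro i j hij
    simp only [Matrix.of_apply]
    rw [if_neg (by omega), hij, zchoose, if_pos (by omega)]
    rw [show ((s (↑j + 1) : ℤ) - s (↑j + 1) + ((B + 1 : ℕ) : ℤ) - 1).toNat = B by omega]
    simp
  · intro i j hij
    simp only [Matrix.of_apply]
    have h1 := s_lt k s hmono (j + 1) i (by omega) (by omega)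
    rw [if_neg (by omega), zchoose]
    split_ifs with h
    · rw [Nat.choose_eq_zero_of_lt (by omega)]; simp
    · simp
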